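/- In the cyclotomic BMW algebra B_n^k(R), for every 1 ≤ i ≤ n−1 and every non-negative integer p: (i) X_i(Y_i')^p = (Y_{i+1}')^p X_i − δΣ_{s=1}^{p}(Y_{i+1}')^s(Y_i')^{p−s} + δΣ_{s=1}^{p}(Y_{i+1}')^s e_i (Y_i')^{p−s}; (ii) X_i(Y_i')^{−p} = (Y_{i+1}')^{−p} X_i + δΣ_{s=1}^{p}(Y_{i+1}')^{s−p}(Y_i')^{−s} − δΣ_{s=1}^{p}(Y_{i+1}')^{s−p} e_i (Y_i')^{−s}. -/

import Mathlib

/-!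
Cyclotomic BMW algebra `B_n^k(R)`, presented as the quotient of the free `R`-algebra on
generators `Y, Y⁻¹, Xᵢ, Xᵢ⁻¹ (1 ≤ i ≤ n-1), eᵢ (1 ≤ i ≤ n-1)` by the defining relations.
Generators with out-of-range indices are identified with `1` (resp. `0` for the `eᵢ`),
so that the quotient is exactly the cyclotomic BMW algebra.
-/

inductive BMWGen : Type
  | Y : BMWGen
  | Yinv : BMWGen
  | X : ℕ → BMWGen
  | Xinv : ℕ → BMWGen
  | E : ℕ → BMWGen

namespace CBMW

/-- The parameters of a cyclotomic BMW algebra: `n`, `k`, units `q, λ, q₀` and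
families `qc` (the `qᵢ`, with `qc 0 = q₀`) and `A` (the `Aᵢ`). -/
structure Params (R : Type) [CommRing R] where
  n : ℕ
  k : ℕ
  q : Rˣ
  lam : Rˣ
  q0 : Rˣ
  qc : ℕ → R
  A : ℕ → R

variable {R : Type} [CommRing R]

abbrev F (R : Type) [CommRing R] := FreeAlgebra R BMWGen

def fY : F R := FreeAlgebra.ι R BMWGen.Y
def fYi : F R := FreeAlgebra.ι R BMWGen.Yinv
def fX (i : ℕ) : F R := FreeAlgebra.ι R (BMWGen.X i)
def fXi (i : ℕ) : F R := FreeAlgebra.ι R (BMWGen.Xinv i)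
def fE (i : ℕ) : F R := FreeAlgebra.ι R (BMWGen.E i)

/-- `δ = q - q⁻¹`. -/
def Params.delta (P : Params R) : R := (P.q : R) - ((P.q⁻¹ : Rˣ) : R)

/-- `λ⁻¹` as an element of `R`. -/
def Params.laminv (P : Params R) : R := ((P.lam⁻¹ : Rˣ) : R)

/-- The defining relations of the cyclotomic BMW algebra. -/
inductive Rel (P : Params R) : F R → F R → Prop
  | X_inv_right {i : ℕ} (h1 : 1 ≤ i) (h2 : i ≤ P.n - 1) : Rel P (fX i * fXi i) 1
  | X_inv_left {i : ℕ} (h1 : 1 ≤ i) (h2 : i ≤ P.n - 1) : Rel P (fXi i * fX i) 1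
  | Y_inv_right : Rel P (fY * fYi) 1
  | Y_inv_left : Rel P (fYi * fY) 1
  | X_invalid {i : ℕ} (h : i = 0 ∨ P.n - 1 < i) : Rel P (fX i) 1
  | Xi_invalid {i : ℕ} (h : i = 0 ∨ P.n - 1 < i) : Rel P (fXi i) 1
  | E_invalid {i : ℕ} (h : i = 0 ∨ P.n - 1 < i) : Rel P (fE i) 0
  | skein {i : ℕ} (h1 : 1 ≤ i) (h2 : i ≤ P.n - 1) :
      Rel P (fX i - fXi i) (P.delta • ((1 : F R) - fE i))
  | XX_far {i j : ℕ} (h1 : 1 ≤ i) (h2 : i ≤ P.n - 1) (h3 : 1 ≤ j) (h4 : j ≤ P.n - 1)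
      (h : i + 2 ≤ j ∨ j + 2 ≤ i) : Rel P (fX i * fX j) (fX j * fX i)
  | braid {i : ℕ} (h1 : 1 ≤ i) (h2 : i + 1 ≤ P.n - 1) :
      Rel P (fX i * fX (i+1) * fX i) (fX (i+1) * fX i * fX (i+1))
  | XE_far {i j : ℕ} (h1 : 1 ≤ i) (h2 : i ≤ P.n - 1) (h3 : 1 ≤ j) (h4 : j ≤ P.n - 1)
      (h : i + 2 ≤ j ∨ j + 2 ≤ i) : Rel P (fX i * fE j) (fE j * fX i)
  | EE_far {i j : ℕ} (h1 : 1 ≤ i) (h2 : i ≤ P.n - 1) (h3 : 1 ≤ j) (h4 : j ≤ P.n - 1)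
      (h : i + 2 ≤ j ∨ j + 2 ≤ i) : Rel P (fE i * fE j) (fE j * fE i)
  | untwist_right {i : ℕ} (h1 : 1 ≤ i) (h2 : i ≤ P.n - 1) :
      Rel P (fX i * fE i) ((P.lam : R) • fE i)
  | untwist_left {i : ℕ} (h1 : 1 ≤ i) (h2 : i ≤ P.n - 1) :
      Rel P (fE i * fX i) ((P.lam : R) • fE i)
  | XXE {i j : ℕ} (h1 : 1 ≤ i) (h2 : i ≤ P.n - 1) (h3 : 1 ≤ j) (h4 : j ≤ P.n - 1)
      (h : j = i + 1 ∨ i = j + 1) : Rel P (fX i * fX j * fE i) (fE j * fE i)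
  | EXX {i j : ℕ} (h1 : 1 ≤ i) (h2 : i ≤ P.n - 1) (h3 : 1 ≤ j) (h4 : j ≤ P.n - 1)
      (h : j = i + 1 ∨ i = j + 1) : Rel P (fE j * fE i) (fE j * fX i * fX j)
  | EEE_up {i : ℕ} (h1 : 1 ≤ i) (h2 : i + 1 ≤ P.n - 1) :
      Rel P (fE i * fE (i+1) * fE i) (fE i)
  | EEE_down {i : ℕ} (h1 : 1 ≤ i) (h2 : i + 1 ≤ P.n - 1) :
      Rel P (fE (i+1) * fE i * fE (i+1)) (fE (i+1))
  | E_sq {i : ℕ} (h1 : 1 ≤ i) (h2 : i ≤ P.n - 1) : Rel P (fE i * fE i) (P.A 0 • fE i)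
  | cyclo : Rel P (fY ^ P.k) (∑ i ∈ Finset.range P.k, P.qc i • fY ^ i)
  | braidB (h : 2 ≤ P.n) :
      Rel P (fX 1 * fY * fX 1 * fY) (fY * fX 1 * fY * fX 1)
  | YX_comm {i : ℕ} (h1 : 2 ≤ i) (h2 : i ≤ P.n - 1) : Rel P (fY * fX i) (fX i * fY)
  | YE_comm {i : ℕ} (h1 : 2 ≤ i) (h2 : i ≤ P.n - 1) : Rel P (fY * fE i) (fE i * fY)
  | YXYE (h : 2 ≤ P.n) : Rel P (fY * fX 1 * fY * fE 1) (P.laminv • fE 1)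
  | EYXY (h : 2 ≤ P.n) : Rel P (fE 1 * (fY * fX 1 * fY)) (P.laminv • fE 1)
  | EYE {m : ℕ} (h : 2 ≤ P.n) (hm : m ≤ P.k - 1) :
      Rel P (fE 1 * fY ^ m * fE 1) (P.A m • fE 1)

/-- The cyclotomic BMW algebra `B_n^k(R)`. -/
abbrev Alg (P : Params R) := RingQuot (Rel P)

def pr (P : Params R) : F R →ₐ[R] Alg P := RingQuot.mkAlgHom R (Rel P)

/-- The generator `Y`. -/
def Yg (P : Params R) : Alg P := pr P fY
/-- The generator `Y⁻¹`. -/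
def Ygi (P : Params R) : Alg P := pr P fYi
/-- The generator `Xᵢ`. -/
def Xg (P : Params R) (i : ℕ) : Alg P := pr P (fX i)
/-- The generator `Xᵢ⁻¹`. -/
def Xgi (P : Params R) (i : ℕ) : Alg P := pr P (fXi i)
/-- The generator `eᵢ`. -/
def Eg (P : Params R) (i : ℕ) : Alg P := pr P (fE i)

/-- `X₁ X₂ ⋯ X_m`. -/
def upX (P : Params R) : ℕ → Alg P
  | 0 => 1
  | m + 1 => upX P m * Xg P (m + 1)

/-- `X_m ⋯ X₂ X₁`. -/
def downX (P : Params R) : ℕ → Alg P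
  | 0 => 1
  | m + 1 => Xg P (m + 1) * downX P m

/-- `X₁⁻¹ X₂⁻¹ ⋯ X_m⁻¹`. -/
def upXi (P : Params R) : ℕ → Alg P
  | 0 => 1
  | m + 1 => upXi P m * Xgi P (m + 1)

/-- `X_m⁻¹ ⋯ X₂⁻¹ X₁⁻¹`. -/
def downXi (P : Params R) : ℕ → Alg P
  | 0 => 1
  | m + 1 => Xgi P (m + 1) * downXi P m

/-- `Yᵢ' = X_{i-1} ⋯ X₁ Y X₁ ⋯ X_{i-1}`. -/
def Yp (P : Params R) (i : ℕ) : Alg P := downX P (i - 1) * Yg P * upX P (i - 1)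

/-- `(Yᵢ')⁻¹ = X_{i-1}⁻¹ ⋯ X₁⁻¹ Y⁻¹ X₁⁻¹ ⋯ X_{i-1}⁻¹`. -/
def YpInv (P : Params R) (i : ℕ) : Alg P := downXi P (i - 1) * Ygi P * upXi P (i - 1)

/-- `(Yᵢ')^p` for an integer exponent `p`. -/
def Ypow (P : Params R) (i : ℕ) (p : ℤ) : Alg P :=
  if 0 ≤ p then Yp P i ^ p.toNat else YpInv P i ^ (-p).toNat

/-- `Y^{s 1} (Y₂')^{s 2} ⋯ (Y_m')^{s m}`. -/
def YpowProd (P : Params R) (s : ℕ → ℤ) : ℕ → Alg P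
  | 0 => 1
  | m + 1 => YpowProd P s m * Ypow P (m + 1) (s (m + 1))

/-- The subalgebra `B_l` generated by `Y^{±1}, X₁^{±1}, …, X_{l-1}^{±1}, e₁, …, e_{l-1}`. -/
def Bsub (P : Params R) (l : ℕ) : Subalgebra R (Alg P) :=
  Algebra.adjoin R
    ({Yg P, Ygi P} ∪
      {x | ∃ i, 1 ≤ i ∧ i + 1 ≤ l ∧ (x = Xg P i ∨ x = Xgi P i ∨ x = Eg P i)})

/-- `α_{ijl}^p = (Yᵢ')^p Xᵢ ⋯ X_{j-1} e_j ⋯ e_l`. -/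
def alpha (P : Params R) (i j l : ℕ) (p : ℤ) : Alg P :=
  Ypow P i p * ((List.range' i (j - i)).map fun t => Xg P t).prod *
    ((List.range' j (l + 1 - j)).map fun t => Eg P t).prod

/-- The set `P = {⌊k/2⌋ - (k-1), …, ⌊k/2⌋}` of `k` consecutive integers. -/
def Pset (k : ℕ) : Set ℤ := {p | (↑(k / 2) : ℤ) - ((k : ℤ) - 1) ≤ p ∧ p ≤ (↑(k / 2) : ℤ)}

/-- `α_{i₁,j₁,l-1}^{s₁} ⋯ α_{i_m,j_m,l-2m+1}^{s_m}`. -/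
def alphaChain (P : Params R) (l : ℕ) (ii jj : ℕ → ℕ) (ss : ℕ → ℤ) : ℕ → Alg P
  | 0 => 1
  | m + 1 => alphaChain P l ii jj ss m *
      alpha P (ii (m + 1)) (jj (m + 1)) (l + 1 - 2 * (m + 1)) (ss (m + 1))

/-- `α_{i₁,j₁,l-2}^{s₁} ⋯ α_{i_m,j_m,l-2m}^{s_m}`. -/
def alphaChainBar (P : Params R) (l : ℕ) (ii jj : ℕ → ℕ) (ss : ℕ → ℤ) : ℕ → Alg P
  | 0 => 1
  | m + 1 => alphaChainBar P l ii jj ss m *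
      alpha P (ii (m + 1)) (jj (m + 1)) (l - 2 * (m + 1)) (ss (m + 1))

/-- `E_{l,m} = e_{l-1} e_{l-3} ⋯ e_{l-2m+1}`. -/
def Echain (P : Params R) (l : ℕ) : ℕ → Alg P
  | 0 => 1
  | m + 1 => Echain P l m * Eg P (l + 1 - 2 * (m + 1))

/-- The set `V_{l,m}^g`. -/
def Vg (P : Params R) (l m : ℕ) : Set (Alg P) :=
  {x | ∃ ii jj : ℕ → ℕ, ∃ ss : ℕ → ℤ,
    (∀ t, 1 ≤ t → t ≤ m →
      1 ≤ ii t ∧ ii t ≤ jj t ∧ jj t ≤ l + 1 - 2 * t ∧ ss t ∈ Pset P.k) ∧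
    x = alphaChain P l ii jj ss m}

/-- The set `V_{l,m}`. -/
def V (P : Params R) (l m : ℕ) : Set (Alg P) :=
  {x | ∃ ii jj : ℕ → ℕ, ∃ ss : ℕ → ℤ,
    (∀ t, 1 ≤ t → t ≤ m →
      1 ≤ ii t ∧ ii t ≤ jj t ∧ jj t ≤ l + 1 - 2 * t ∧ ss t ∈ Pset P.k) ∧
    (∀ t, 1 ≤ t → t + 1 ≤ m → ii (t + 1) < ii t) ∧
    x = alphaChain P l ii jj ss m}

/-- The set `V̄_{l,m}`. -/
def Vbar (P : Params R) (l m : ℕ) : Set (Alg P) :=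
  {x | ∃ ii jj : ℕ → ℕ, ∃ ss : ℕ → ℤ,
    (∀ t, 1 ≤ t → t ≤ m →
      1 ≤ ii t ∧ ii t ≤ jj t ∧ jj t ≤ l + 1 - 2 * t ∧ ss t ∈ Pset P.k) ∧
    (∀ t, 1 ≤ t → t + 1 ≤ m → ii (t + 1) < ii t) ∧
    x = alphaChainBar P l ii jj ss m}

end CBMW

open CBMW

section CommutationFormulas

variable {R : Type*} [CommRing R] {B : Type*} [Ring B] [Algebra R B]

/-- If `x - x' = δ (1 - e)` and `x * a = b * x'`, then `x` commutes past powers of `a`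
up to correction terms. -/
lemma mul_pow_eq_of_skein {δ : R} {x x' e a b : B} (hs : x - x' = δ • (1 - e))
    (h : x * a = b * x') (p : ℕ) :
    x * a ^ p = b ^ p * x - δ • ∑ s ∈ Finset.Icc 1 p, b ^ s * a ^ (p - s)
      + δ • ∑ s ∈ Finset.Icc 1 p, b ^ s * e * a ^ (p - s) := by
  have hx : x * a = b * x - δ • b + δ • (b * e) := by
    rw [h, ← sub_sub_cancel x x', hs, mul_sub, mul_smul_comm, mul_sub, mul_one, smul_sub]
    abel
  induction p with
  | zero => simp
  | succ p ih =>
    have shift (c : B) : ∑ s ∈ Finset.Icc 1 p, b ^ s * c * a ^ (p + 1 - s)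
        = (∑ s ∈ Finset.Icc 1 p, b ^ s * c * a ^ (p - s)) * a := by
      rw [Finset.sum_mul]
      refine Finset.sum_congr rfl fun s hs => ?_
      rw [Nat.succ_sub (Finset.mem_Icc.mp hs).2, pow_succ, mul_assoc _ _ a]
    have shift_one := shift 1
    simp only [mul_one] at shift_one
    rw [Finset.sum_Icc_succ_top (by lia), Finset.sum_Icc_succ_top (by lia), shift, shift_one,
      pow_succ a, ← mul_assoc, ih, add_mul, sub_mul, mul_assoc (b ^ p), hx]
    simp only [mul_add, mul_sub, mul_smul_comm, smul_mul_assoc, smul_add, pow_succ b, mul_assoc,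
      Nat.sub_self, pow_zero, mul_one]
    abel

/-- If `x - x' = δ (1 - e)` and `b * x = x' * a`, then `x` commutes past powers of `a`
up to correction terms. -/
lemma mul_pow_eq_of_skein' {δ : R} {x x' e a b : B} (hs : x - x' = δ • (1 - e))
    (h : b * x = x' * a) (p : ℕ) :
    x * a ^ p = b ^ p * x + δ • ∑ s ∈ Finset.Icc 1 p, b ^ (p - s) * a ^ s
      - δ • ∑ s ∈ Finset.Icc 1 p, b ^ (p - s) * e * a ^ s := by
  have hx : x * a = b * x + δ • a - δ • (e * a) := by
    rw [h, ← sub_add_cancel x x', hs, add_mul, smul_mul_assoc, sub_mul, one_mul, smul_sub]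
    abel_nf
  induction p with
  | zero => simp
  | succ p ih =>
    have shift (c : B) : ∑ s ∈ Finset.Icc 1 p, b ^ (p + 1 - s) * c * a ^ s
        = b * ∑ s ∈ Finset.Icc 1 p, b ^ (p - s) * c * a ^ s := by
      rw [Finset.mul_sum]
      refine Finset.sum_congr rfl fun s hs => ?_
      rw [Nat.succ_sub (Finset.mem_Icc.mp hs).2, pow_succ']
      simp only [mul_assoc]
    have shift_one := shift 1
    simp only [mul_one] at shift_one
    rw [Finset.sum_Icc_succ_top (by lia), Finset.sum_Icc_succ_top (by lia), shift, shift_one,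
      pow_succ' a, ← mul_assoc x, hx, sub_mul, add_mul, mul_assoc b, ih]
    simp only [mul_add, mul_sub, mul_smul_comm, smul_mul_assoc, smul_add, pow_succ' b, mul_assoc,
      Nat.sub_self, pow_zero, one_mul]
    abel

end CommutationFormulas

namespace CBMW

variable {R : Type} [CommRing R] (P : Params R)

lemma Ypow_natCast (i p : ℕ) : Ypow P i (p : ℤ) = Yp P i ^ p := by
  simp [Ypow]

lemma Ypow_neg_natCast (i p : ℕ) : Ypow P i (-(p : ℤ)) = YpInv P i ^ p := by
  rcases p.eq_zero_or_pos with rfl | hp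
  · simp [Ypow]
  · rw [Ypow, if_neg (by lia), neg_neg, Int.toNat_natCast]

lemma Yp_succ {i : ℕ} (hi : 1 ≤ i) : Yp P (i + 1) = Xg P i * Yp P i * Xg P i := by
  obtain ⟨j, rfl⟩ := Nat.exists_eq_add_of_le' hi
  simp only [Yp, Nat.add_sub_cancel, downX, upX, mul_assoc]

lemma YpInv_succ {i : ℕ} (hi : 1 ≤ i) : YpInv P (i + 1) = Xgi P i * YpInv P i * Xgi P i := by
  obtain ⟨j, rfl⟩ := Nat.exists_eq_add_of_le' hi
  simp only [YpInv, Nat.add_sub_cancel, downXi, upXi, mul_assoc]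

lemma pr_eq_of_rel {a b : F R} (h : Rel P a b) : pr P a = pr P b :=
  RingQuot.mkAlgHom_rel R h

lemma Xg_mul_Xgi {i : ℕ} (h1 : 1 ≤ i) (h2 : i ≤ P.n - 1) : Xg P i * Xgi P i = 1 := by
  simpa [Xg, Xgi] using pr_eq_of_rel P (Rel.X_inv_right h1 h2)

lemma Xgi_mul_Xg {i : ℕ} (h1 : 1 ≤ i) (h2 : i ≤ P.n - 1) : Xgi P i * Xg P i = 1 := by
  simpa [Xg, Xgi] using pr_eq_of_rel P (Rel.X_inv_left h1 h2)

lemma Xg_sub_Xgi {i : ℕ} (h1 : 1 ≤ i) (h2 : i ≤ P.n - 1) :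
    Xg P i - Xgi P i = P.delta • (1 - Eg P i) := by
  have h := pr_eq_of_rel P (Rel.skein h1 h2)
  rwa [map_sub, map_smul, map_sub, map_one] at h

end CBMW

/-- The commutation formulas for `Xᵢ` past positive and negative powers
of `Yᵢ'` (equations (17) and (18) of the paper). -/
theorem statement3 {R : Type} [CommRing R] (P : Params R)
    (hn : 1 ≤ P.n) (hk : 1 ≤ P.k) (hq0 : P.qc 0 = (P.q0 : R))
    (hcomp : (P.lam : R) - P.laminv = P.delta * (1 - P.A 0)) :
    ∀ (i : ℕ), 1 ≤ i → i ≤ P.n - 1 → ∀ p : ℕ,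
      (Xg P i * Ypow P i (p : ℤ) =
        Ypow P (i + 1) (p : ℤ) * Xg P i
          - P.delta • ∑ s ∈ Finset.Icc 1 p,
              Ypow P (i + 1) (s : ℤ) * Ypow P i ((p : ℤ) - (s : ℤ))
          + P.delta • ∑ s ∈ Finset.Icc 1 p,
              Ypow P (i + 1) (s : ℤ) * Eg P i * Ypow P i ((p : ℤ) - (s : ℤ))) ∧
      (Xg P i * Ypow P i (-(p : ℤ)) =
        Ypow P (i + 1) (-(p : ℤ)) * Xg P i
          + P.delta • ∑ s ∈ Finset.Icc 1 p,
              Ypow P (i + 1) ((s : ℤ) - (p : ℤ)) * Ypow P i (-(s : ℤ))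
          - P.delta • ∑ s ∈ Finset.Icc 1 p,
              Ypow P (i + 1) ((s : ℤ) - (p : ℤ)) * Eg P i * Ypow P i (-(s : ℤ))) := by
  intro i h1 h2 p
  have hs := Xg_sub_Xgi P h1 h2
  have hY : Xg P i * Yp P i = Yp P (i + 1) * Xgi P i := by
    rw [Yp_succ P h1, mul_assoc _ (Xg P i), Xg_mul_Xgi P h1 h2, mul_one]
  have hYInv : YpInv P (i + 1) * Xg P i = Xgi P i * YpInv P i := by
    rw [YpInv_succ P h1, mul_assoc _ (Xgi P i) (Xg P i), Xgi_mul_Xg P h1 h2, mul_one]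
  have pos (s : ℕ) (hsp : s ∈ Finset.Icc 1 p) :
      Ypow P i ((p : ℤ) - (s : ℤ)) = Yp P i ^ (p - s) := by
    rw [← Nat.cast_sub (Finset.mem_Icc.mp hsp).2, Ypow_natCast]
  have neg (s : ℕ) (hsp : s ∈ Finset.Icc 1 p) :
      Ypow P (i + 1) ((s : ℤ) - (p : ℤ)) = YpInv P (i + 1) ^ (p - s) := by
    rw [← neg_sub, ← Nat.cast_sub (Finset.mem_Icc.mp hsp).2, Ypow_neg_natCast]
  constructor
  · simp +contextual only [pos, Ypow_natCast]
    exact mul_pow_eq_of_skein hs hY p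
  · simp +contextual only [neg, Ypow_neg_natCast]
    exact mul_pow_eq_of_skein' hs hYInv p
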